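/- Let A ∈ ℤ^{m×n} with n ≥ 2, b ∈ ℤ^m, l, u ∈ ℤ^n with l ≤ u, and let f : ℤ^n → ℤ be separable convex. Let x and x* be feasible for (IP)_{A,b,l,u,f} with f(x*) < f(x). Then there exist g ∈ 𝒢(A) and an integer α ≥ 1 such that l ≤ x + αg ≤ u and f(x) − f(x + αg) ≥ (f(x) − f(x*)) / (2n − 2). -/

import Mathlib

/-- Two integer vectors are sign-compatible if they lie in the same orthant. -/
def SignCompat {ι : Type*} (x y : ι → ℤ) : Prop := ∀ i, 0 ≤ x i * y i

/-- The conformal order: `y ⊑ x` iff `y` and `x` are sign-compatible and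
`|y i| ≤ |x i|` for every coordinate. -/
def Conforms {ι : Type*} (y x : ι → ℤ) : Prop :=
  SignCompat y x ∧ ∀ i, |y i| ≤ |x i|

/-- The Graver basis of an integer matrix `A`: the set of `⊑`-minimal nonzero
elements of `ker_ℤ(A)`. -/
def GraverBasis {κ ι : Type*} [Fintype ι] (A : Matrix κ ι ℤ) : Set (ι → ℤ) :=
  {g | g ≠ 0 ∧ A.mulVec g = 0 ∧
    ∀ h : ι → ℤ, h ≠ 0 → A.mulVec h = 0 → Conforms h g → h = g}

/-- A function `ℤ → ℤ` is convex iff its successive differences are nondecreasing. -/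
def IntConvex (h : ℤ → ℤ) : Prop :=
  ∀ a b : ℤ, a ≤ b → h (a + 1) - h a ≤ h (b + 1) - h b

/-- A separable convex function: a sum of univariate convex integer functions
of the individual coordinates. -/
def SepConvex {ι : Type*} [Fintype ι] (f : (ι → ℤ) → ℤ) : Prop :=
  ∃ g : ι → ℤ → ℤ, (∀ i, IntConvex (g i)) ∧ ∀ x, f x = ∑ i, g i (x i)

open Finset

lemma conforms_iff {ι : Type*} {y x : ι → ℤ} :
    Conforms y x ↔ ∀ i, (0 ≤ y i ∧ y i ≤ x i) ∨ (x i ≤ y i ∧ y i ≤ 0) := by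
  constructor
  · rintro ⟨h₁, h₂⟩ i
    have h := h₁ i
    have h' := h₂ i
    rcases lt_trichotomy (y i) 0 with hy | hy | hy
    · have : x i ≤ 0 := by by_contra hx; push Not at hx; nlinarith
      rw [abs_of_neg hy, abs_of_nonpos this] at h'
      right; omega
    · rw [hy]; rcases le_total 0 (x i) with hx | hx <;> simp [hx]
    · have : 0 ≤ x i := by by_contra hx; push Not at hx; nlinarith
      rw [abs_of_pos hy, abs_of_nonneg this] at h'
      left; omega
  · intro h
    refine ⟨fun i => ?_, fun i => ?_⟩ <;> rcases h i with ⟨h₁, h₂⟩ | ⟨h₁, h₂⟩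
    · exact mul_nonneg h₁ (h₁.trans h₂)
    · exact mul_nonneg_of_nonpos_of_nonpos h₂ (h₁.trans h₂)
    · rwa [abs_of_nonneg h₁, abs_of_nonneg (h₁.trans h₂)]
    · rw [abs_of_nonpos h₂, abs_of_nonpos (h₁.trans h₂)]; omega

lemma Conforms.trans {ι : Type*} {x y z : ι → ℤ} (h₁ : Conforms x y) (h₂ : Conforms y z) :
    Conforms x z := by
  rw [conforms_iff] at *
  intro i
  have := h₁ i
  have := h₂ i
  omega

lemma Conforms.refl {ι : Type*} (x : ι → ℤ) : Conforms x x :=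
  conforms_iff.2 fun i => by omega

lemma Conforms.sub {ι : Type*} {x y : ι → ℤ} (h : Conforms x y) : Conforms (y - x) y := by
  rw [conforms_iff] at *
  intro i
  have := h i
  simp only [Pi.sub_apply]
  omega

lemma Conforms.natAbs_le {ι : Type*} {x y : ι → ℤ} (h : Conforms x y) (i : ι) :
    (x i).natAbs ≤ (y i).natAbs := by
  have := conforms_iff.1 h i
  omega

lemma Conforms.eq_of_natAbs_le {ι : Type*} {x y : ι → ℤ} (h : Conforms x y)
    (h' : ∀ i, (y i).natAbs ≤ (x i).natAbs) : x = y := by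
  funext i
  have := conforms_iff.1 h i
  have := h' i
  omega

lemma finite_conforms {ι : Type*} [Finite ι] (z : ι → ℤ) : {g | Conforms g z}.Finite := by
  have := Fintype.ofFinite ι
  classical
  refine (Set.finite_Icc (fun i => -|z i|) (fun i => |z i|)).subset fun g hg => ?_
  exact ⟨fun i => (abs_le.1 (hg.2 i)).1, fun i => (abs_le.1 (hg.2 i)).2⟩

/-- The Graver basis elements conforming to `z`. -/
noncomputable def graverBelow {κ ι : Type*} [Fintype ι] (A : Matrix κ ι ℤ) (z : ι → ℤ) :
    Finset (ι → ℤ) :=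
  ((finite_conforms z).inter_of_right (GraverBasis A)).toFinset

lemma mem_graverBelow {κ ι : Type*} [Fintype ι] {A : Matrix κ ι ℤ} {z g : ι → ℤ} :
    g ∈ graverBelow A z ↔ g ∈ GraverBasis A ∧ Conforms g z := by
  simp [graverBelow]

lemma exists_graver_conforms {κ ι : Type*} [Fintype ι] (A : Matrix κ ι ℤ) {r : ι → ℤ}
    (hr : r ≠ 0) (hA : A.mulVec r = 0) : ∃ g ∈ GraverBasis A, Conforms g r := by
  obtain ⟨g, ⟨hg0, hgA, hgr⟩, hmin⟩ :=
    (InvImage.wf (fun y : ι → ℤ => ∑ i, (y i).natAbs) Nat.lt_wfRel.wf).has_min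
      {y | y ≠ 0 ∧ A.mulVec y = 0 ∧ Conforms y r} ⟨r, hr, hA, Conforms.refl r⟩
  refine ⟨g, ⟨hg0, hgA, fun h h0 hhA hhg => hhg.eq_of_natAbs_le ?_⟩, hgr⟩
  by_contra! hlt
  obtain ⟨i, hi⟩ := hlt
  exact hmin h ⟨h0, hhA, hhg.trans hgr⟩
    (Finset.sum_lt_sum (fun j _ => hhg.natAbs_le j) ⟨i, Finset.mem_univ i, hi⟩)

/-- Every integer kernel vector is a conformal nonnegative integer combination of
Graver basis elements. -/
lemma exists_conformal_decomposition {κ ι : Type*} [Fintype ι] (A : Matrix κ ι ℤ)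
    (z r : ι → ℤ) (hA : A.mulVec r = 0) (hrz : Conforms r z) :
    ∃ μ : (ι → ℤ) → ℕ, ∑ g ∈ graverBelow A z, μ g • g = r := by
  classical
  induction hN : ∑ i, (r i).natAbs using Nat.strong_induction_on generalizing r with
  | _ N ih =>
  by_cases hr : r = 0
  · exact ⟨0, by simp [hr]⟩
  obtain ⟨g, hg, hgr⟩ := exists_graver_conforms A hr hA
  have hlt : ∑ i, ((r - g) i).natAbs < N := by
    rw [← hN]
    obtain ⟨i, hi⟩ := Function.ne_iff.1 hg.1
    refine Finset.sum_lt_sum (fun j _ => hgr.sub.natAbs_le j) ⟨i, Finset.mem_univ i, ?_⟩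
    have := conforms_iff.1 hgr i
    simp only [Pi.sub_apply, Pi.zero_apply] at hi ⊢
    omega
  obtain ⟨μ, hμ⟩ := ih _ hlt (r - g) (by rw [Matrix.mulVec_sub, hA, hg.2.1, sub_zero])
    (hgr.sub.trans hrz) rfl
  refine ⟨fun h => μ h + if h = g then 1 else 0, ?_⟩
  simp only [add_smul, Finset.sum_add_distrib, hμ, ite_smul, one_smul, zero_smul,
    Finset.sum_ite_eq', mem_graverBelow.2 ⟨hg, hgr.trans hrz⟩, if_true, sub_add_cancel]

/-- Among the nonnegative combinations of vectors in an open half-space representing a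
given vector, some one of maximal total weight has linearly independent support. -/
lemma exists_maximal_basic_combination {ι σ : Type*} [Fintype ι] [Fintype σ]
    (v : σ → ι → ℝ) (w : ι → ℝ) (hw : ∀ g, 1 ≤ ∑ i, w i * v g i)
    (lam₀ : σ → ℝ) (h₀ : 0 ≤ lam₀) :
    ∃ lam : σ → ℝ, 0 ≤ lam ∧ ∑ g, lam g • v g = ∑ g, lam₀ g • v g ∧
      (∀ nu : σ → ℝ, 0 ≤ nu → ∑ g, nu g • v g = ∑ g, lam₀ g • v g →
        ∑ g, nu g ≤ ∑ g, lam g) ∧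
      LinearIndependent ℝ (fun g : {g // lam g ≠ 0} => v g) := by
  classical
  set K : Set (σ → ℝ) := {lam | 0 ≤ lam ∧ ∑ g, lam g • v g = ∑ g, lam₀ g • v g}
  set M : ℝ := ∑ i, w i * (∑ g, lam₀ g • v g) i with hM
  have hKM : K ⊆ Set.Icc 0 (fun _ => M) := by
    rintro lam ⟨hl, he⟩
    refine ⟨hl, fun g => ?_⟩
    have h1 : M = ∑ g, lam g * ∑ i, w i * v g i := by
      rw [hM, ← he]
      simp only [Finset.sum_apply, Pi.smul_apply, smul_eq_mul, Finset.mul_sum]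
      rw [Finset.sum_comm]
      exact Finset.sum_congr rfl fun _ _ => Finset.sum_congr rfl fun _ _ => by ring
    rw [h1]
    calc lam g ≤ lam g * ∑ i, w i * v g i := le_mul_of_one_le_right (hl g) (hw g)
      _ ≤ _ := Finset.single_le_sum (f := fun g => lam g * ∑ i, w i * v g i)
        (fun h _ => mul_nonneg (hl h) (zero_le_one.trans (hw h))) (Finset.mem_univ g)
  have hKcl : IsClosed K :=
    isClosed_Ici.inter (isClosed_eq (by fun_prop) continuous_const)
  have hKc : IsCompact K := isCompact_Icc.of_isClosed_subset hKcl hKM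
  obtain ⟨m, hmK, hm⟩ := hKc.exists_isMaxOn ⟨lam₀, h₀, rfl⟩
    (f := fun lam : σ → ℝ => ∑ g, lam g) (by fun_prop)
  set F : Set (σ → ℝ) := K ∩ {lam | ∑ g, lam g = ∑ g, m g}
  have hFc : IsCompact F := hKc.inter_right (isClosed_eq (by fun_prop) continuous_const)
  obtain ⟨lam, hlam⟩ := hFc.extremePoints_nonempty ⟨m, hmK, rfl⟩
  rw [mem_extremePoints] at hlam
  obtain ⟨⟨⟨hl, he⟩, hs⟩, hext⟩ := hlam
  have hmax : ∀ nu : σ → ℝ, 0 ≤ nu → ∑ g, nu g • v g = ∑ g, lam₀ g • v g →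
      ∑ g, nu g ≤ ∑ g, lam g := fun nu hn hne => (hm ⟨hn, hne⟩).trans_eq hs.symm
  refine ⟨lam, hl, he, hmax, ?_⟩
  rw [Fintype.linearIndependent_iff]
  intro c hc g₀
  set d : σ → ℝ := fun g => if h : lam g ≠ 0 then c ⟨g, h⟩ else 0 with hd
  have hdsum : ∑ g, d g • v g = 0 := by
    have h0 : ∀ g, g ∉ ({g | lam g ≠ 0} : Finset σ) → d g • v g = 0 := by
      intro g hg
      have hg' : lam g = 0 := by simpa using hg
      simp [hd, hg']
    rw [← hc, ← Finset.sum_subset (Finset.subset_univ _) (fun g _ => h0 g),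
      Finset.sum_subtype {g | lam g ≠ 0} (p := fun g => lam g ≠ 0) (by simp)]
    refine Finset.sum_congr rfl fun g _ => ?_
    simp only [hd, dif_pos g.2]
  obtain ⟨ε, hε, hεd⟩ : ∃ ε > 0, ∀ g, ε * |d g| ≤ lam g := by
    have : ∀ᶠ ε in nhdsWithin (0 : ℝ) (Set.Ioi 0), ∀ g, ε * |d g| ≤ lam g := by
      rw [Filter.eventually_all]
      intro g
      by_cases hg : lam g = 0
      · simp [hd, hg]
      · have hpos : 0 < lam g := lt_of_le_of_ne (hl g) (Ne.symm hg)
        have ht : Filter.Tendsto (fun ε : ℝ => ε * |d g|) (nhds 0) (nhds (0 * |d g|)) :=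
          Continuous.tendsto (by fun_prop) 0
        rw [zero_mul] at ht
        exact ((ht.eventually_lt_const hpos).filter_mono nhdsWithin_le_nhds).mono
          fun _ h => h.le
    obtain ⟨ε, h, hε⟩ := (this.and self_mem_nhdsWithin).exists
    exact ⟨ε, hε, h⟩
  have hp : ∀ s : ℝ, |s| ≤ ε → lam + s • d ∈ K := by
    intro s hsε
    refine ⟨fun g => ?_, ?_⟩
    · have h1 : |s * d g| ≤ lam g := by
        rw [abs_mul]
        exact (mul_le_mul_of_nonneg_right hsε (abs_nonneg _)).trans (hεd g)
      have := (abs_le.1 h1).1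
      simp only [Pi.zero_apply, Pi.add_apply, Pi.smul_apply, smul_eq_mul]
      linarith
    · simp only [Pi.add_apply, Pi.smul_apply, smul_eq_mul, add_smul, Finset.sum_add_distrib,
        mul_smul, ← Finset.smul_sum, hdsum, smul_zero, add_zero, he]
  have hsum : ∀ s : ℝ, ∑ g, (lam + s • d) g = ∑ g, lam g + s * ∑ g, d g := by
    intro s
    simp [Finset.sum_add_distrib, Finset.mul_sum]
  have hplus := hp ε (abs_of_pos hε).le
  have hminus := hp (-ε) (by rw [abs_neg, abs_of_pos hε])
  have h1 := hmax _ hplus.1 hplus.2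
  have h2 := hmax _ hminus.1 hminus.2
  rw [hsum] at h1 h2
  have h3 : ε * ∑ g, d g = 0 := by linarith
  have hseg : lam ∈ openSegment ℝ (lam + ε • d) (lam + (-ε) • d) := by
    refine ⟨1 / 2, 1 / 2, by norm_num, by norm_num, by norm_num, ?_⟩
    funext g
    simp only [Pi.add_apply, Pi.smul_apply, smul_eq_mul]
    ring
  have := hext _ ⟨hplus, by rw [Set.mem_ofPred_eq, hsum, h3, add_zero, hs]⟩
    _ ⟨hminus, by rw [Set.mem_ofPred_eq, hsum, neg_mul, h3, neg_zero, add_zero, hs]⟩ hseg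
  have h4 : ε * d g₀ = 0 := by simpa using congrFun this.1 g₀.1
  have h5 : d g₀ = 0 := (mul_eq_zero.1 h4).resolve_left hε.ne'
  simpa [hd, g₀.2] using h5

lemma card_lt_of_linearIndependent_of_orthogonal {σ : Type*} [Fintype σ] {n : ℕ}
    (v : σ → Fin n → ℝ) (hv : LinearIndependent ℝ v) (a : Fin n → ℝ) (ha : a ≠ 0)
    (h : ∀ g, a ⬝ᵥ v g = 0) : Fintype.card σ < n := by
  have hle := hv.fintype_card_le_finrank
  rw [Module.finrank_fin_fun] at hle
  refine lt_of_le_of_ne hle fun heq => ha ?_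
  have htop := hv.span_eq_top_of_card_eq_finrank' (by rw [Module.finrank_fin_fun, heq])
  have h0 : dotProductBilin ℝ ℝ a = 0 := by
    refine LinearMap.ext_on_range htop fun g => ?_
    simpa using h g
  have := LinearMap.congr_fun h0 a
  simpa using this

lemma graverBelow_zero_card_le {κ : Type*} {n : ℕ} (z : Fin n → ℤ) :
    #(graverBelow (0 : Matrix κ (Fin n) ℤ) z) ≤ n := by
  classical
  have : graverBelow (0 : Matrix κ (Fin n) ℤ) z ⊆
      Finset.univ.image fun i => Pi.single i (z i).sign := by
    intro g hg
    obtain ⟨⟨h0, -, hmin⟩, hgz⟩ := mem_graverBelow.1 hg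
    obtain ⟨i, hi⟩ := Function.ne_iff.1 h0
    have hgi := conforms_iff.1 hgz i
    simp only [Pi.zero_apply] at hi
    refine Finset.mem_image.2 ⟨i, Finset.mem_univ i, hmin _ ?_ (Matrix.zero_mulVec _) ?_⟩
    · rw [Ne, Pi.single_eq_zero_iff, Int.sign_eq_zero_iff_zero]
      omega
    · rw [conforms_iff]
      intro j
      by_cases hj : j = i
      · subst hj
        rw [Pi.single_eq_same]
        rcases lt_trichotomy (z j) 0 with h | h | h
        · rw [Int.sign_eq_neg_one_of_neg h]; omega
        · omega
        · rw [Int.sign_eq_one_of_pos h]; omega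
      · rw [Pi.single_eq_of_ne hj]; omega
  calc _ ≤ _ := Finset.card_le_card this
    _ ≤ _ := Finset.card_image_le
    _ = n := by simp

lemma one_le_sum_sign_mul {ι : Type*} [Fintype ι] {g z : ι → ℤ} (hg : g ≠ 0)
    (h : Conforms g z) : 1 ≤ ∑ i, (z i).sign * g i := by
  have hnn : ∀ i, |g i| ≤ (z i).sign * g i := by
    intro i
    rcases conforms_iff.1 h i with ⟨h1, h2⟩ | ⟨h1, h2⟩
    · rcases h1.eq_or_lt with h0 | h0
      · simp [← h0]
      · rw [Int.sign_eq_one_of_pos (h0.trans_le h2), one_mul, abs_of_pos h0]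
    · rcases h2.eq_or_lt with h0 | h0
      · simp [h0]
      · rw [Int.sign_eq_neg_one_of_neg (h1.trans_lt h0), abs_of_neg h0, neg_one_mul]
  obtain ⟨i, hi⟩ := Function.ne_iff.1 hg
  calc 1 ≤ |g i| := Int.one_le_abs hi
    _ ≤ (z i).sign * g i := hnn i
    _ ≤ _ := Finset.single_le_sum (f := fun i => (z i).sign * g i)
      (fun j _ => (abs_nonneg _).trans (hnn j)) (Finset.mem_univ i)

/-- An integer Carathéodory theorem: a kernel vector is a conformal nonnegative integer
combination of at most `2n - 2` Graver basis elements. -/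
lemma exists_sparse_conformal_decomposition {κ : Type*} {n : ℕ} (hn : 2 ≤ n)
    (A : Matrix κ (Fin n) ℤ) (z : Fin n → ℤ) (hz : A.mulVec z = 0) :
    ∃ α : (Fin n → ℤ) → ℕ, ∑ g ∈ graverBelow A z, α g • g = z ∧
      #{g ∈ graverBelow A z | α g ≠ 0} ≤ 2 * n - 2 := by
  classical
  obtain ⟨μ₀, hμ₀⟩ := exists_conformal_decomposition A z z hz (Conforms.refl z)
  by_cases hA0 : A = 0
  · subst hA0
    refine ⟨μ₀, hμ₀, (Finset.card_filter_le _ _).trans ?_⟩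
    have := graverBelow_zero_card_le (κ := κ) z
    omega
  obtain ⟨k, hk⟩ : ∃ k, A k ≠ 0 := by
    by_contra! h
    exact hA0 (funext h)
  set S := graverBelow A z with hS
  set v : S → Fin n → ℝ := fun g i => (g.1 i : ℝ) with hv
  have hcast : ∀ μ : (Fin n → ℤ) → ℕ, ∀ i,
      (∑ g : S, (μ g : ℝ) • v g) i = (((∑ g ∈ S, μ g • g) i : ℤ) : ℝ) := by
    intro μ i
    rw [← Finset.sum_coe_sort S (fun g => μ g • g)]
    simp [hv, Finset.sum_apply]
  obtain ⟨lam, hl, he, hmax, hind⟩ := exists_maximal_basic_combination v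
    (fun i => ((z i).sign : ℝ))
    (fun g => by
      have hg := mem_graverBelow.1 g.2
      simp only [hv]
      exact_mod_cast one_le_sum_sign_mul hg.1.1 hg.2)
    (fun g => (μ₀ g : ℝ)) (fun g => Nat.cast_nonneg _)
  have hz₀ : ∑ g : S, (μ₀ g : ℝ) • v g = fun i => (z i : ℝ) := by
    funext i
    rw [hcast, hμ₀]
  rw [hz₀] at he hmax
  have hcard : #{g | lam g ≠ 0} < n := by
    rw [← Fintype.card_subtype]
    refine card_lt_of_linearIndependent_of_orthogonal _ hind (fun i => (A k i : ℝ)) ?_ ?_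
    · intro h
      exact hk (funext fun i => by simpa using congrFun h i)
    · intro g
      have := congrFun (mem_graverBelow.1 g.1.2).1.2.1 k
      simp only [Matrix.mulVec, dotProduct, Pi.zero_apply, hv] at this ⊢
      exact_mod_cast this
  set fl : (Fin n → ℤ) → ℕ := fun g => if h : g ∈ S then ⌊lam ⟨g, h⟩⌋₊ else 0 with hfl
  have hfl' : ∀ g : S, fl g = ⌊lam g⌋₊ := fun g => by simp [hfl]
  set r : Fin n → ℤ := z - ∑ g ∈ S, fl g • g with hr
  have hr_cast : ∀ i, (r i : ℝ) = ∑ g : S, (lam g - fl g) * v g i := by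
    intro i
    have h1 := hcast fl i
    have h2 := congrFun he i
    simp only [hr, Pi.sub_apply, Int.cast_sub, ← h1, ← h2]
    simp [Finset.sum_apply, sub_mul]
  have hrA : A.mulVec r = 0 := by
    rw [hr, Matrix.mulVec_sub, hz, zero_sub, neg_eq_zero, Matrix.mulVec_sum]
    refine Finset.sum_eq_zero fun g hg => ?_
    rw [Matrix.mulVec_smul, (mem_graverBelow.1 hg).1.2.1, smul_zero]
  have hfrac : ∀ g : S, 0 ≤ lam g - fl g ∧ lam g - fl g ≤ lam g ∧ lam g - fl g ≤ 1 := by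
    intro g
    rw [hfl']
    have h1 := Nat.floor_le (hl g)
    have h2 := (Nat.lt_floor_add_one (lam g)).le
    have h3 : (0 : ℝ) ≤ (⌊lam g⌋₊ : ℝ) := Nat.cast_nonneg _
    exact ⟨by linarith, by linarith, by linarith⟩
  have hrz : Conforms r z := by
    rw [conforms_iff]
    intro i
    have hri := hr_cast i
    have hzi : (z i : ℝ) = ∑ g : S, lam g * v g i := by
      rw [← congrFun he i]; simp [Finset.sum_apply]
    have hsgn : ∀ g : S, (0 ≤ z i → 0 ≤ v g i) ∧ (z i ≤ 0 → v g i ≤ 0) := by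
      intro g
      have := conforms_iff.1 (mem_graverBelow.1 g.2).2 i
      simp only [hv]
      refine ⟨fun h => ?_, fun h => ?_⟩
      · have : 0 ≤ g.1 i := by omega
        exact_mod_cast this
      · have : g.1 i ≤ 0 := by omega
        exact_mod_cast this
    rcases le_total 0 (z i) with h | h
    · left
      have h1 : (0 : ℝ) ≤ r i := by
        rw [hri]
        exact Finset.sum_nonneg fun g _ => mul_nonneg (hfrac g).1 ((hsgn g).1 h)
      have h2 : (r i : ℝ) ≤ z i := by
        rw [hri, hzi]
        exact Finset.sum_le_sum fun g _ =>
          mul_le_mul_of_nonneg_right (hfrac g).2.1 ((hsgn g).1 h)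
      exact ⟨by exact_mod_cast h1, by exact_mod_cast h2⟩
    · right
      have h1 : (r i : ℝ) ≤ 0 := by
        rw [hri]
        exact Finset.sum_nonpos fun g _ =>
          mul_nonpos_of_nonneg_of_nonpos (hfrac g).1 ((hsgn g).2 h)
      have h2 : (z i : ℝ) ≤ r i := by
        rw [hri, hzi]
        exact Finset.sum_le_sum fun g _ =>
          mul_le_mul_of_nonpos_right (hfrac g).2.1 ((hsgn g).2 h)
      exact ⟨by exact_mod_cast h2, by exact_mod_cast h1⟩
  obtain ⟨μ, hμ⟩ := exists_conformal_decomposition A z r hrA hrz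
  rw [← hS] at hμ
  have hsum : ∑ g ∈ S, (fl g + μ g) • g = z := by
    simp only [add_smul, Finset.sum_add_distrib, hμ, hr, add_sub_cancel]
  refine ⟨fun g => fl g + μ g, hsum, ?_⟩
  have hopt := hmax (fun g => ((fl g + μ g : ℕ) : ℝ)) (fun g => Nat.cast_nonneg _)
    (by funext i; rw [hcast (fun g => fl g + μ g), hsum])
  have hμle : ∑ g ∈ S, μ g ≤ #{g | lam g ≠ 0} := by
    have h1 : ∑ g : S, (μ g : ℝ) ≤ ∑ g : S, (lam g - fl g) := by
      simp only [Nat.cast_add, Finset.sum_add_distrib, Finset.sum_sub_distrib] at hopt ⊢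
      linarith
    have h2 : ∑ g : S, (lam g - fl g) ≤ ∑ g : S, if lam g ≠ 0 then (1 : ℝ) else 0 := by
      refine Finset.sum_le_sum fun g _ => ?_
      split_ifs with h
      · exact (hfrac g).2.2
      · have := (hfrac g).2.1
        push Not at h
        linarith
    rw [Finset.sum_boole] at h2
    rw [← Finset.sum_coe_sort S μ]
    exact_mod_cast h1.trans h2
  have hflcard : #{g ∈ S | fl g ≠ 0} ≤ #{g | lam g ≠ 0} := by
    rw [← Finset.card_map (Function.Embedding.subtype (· ∈ S))]
    refine Finset.card_le_card fun g hg => ?_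
    obtain ⟨hgS, hg0⟩ := Finset.mem_filter.1 hg
    refine Finset.mem_map.2 ⟨⟨g, hgS⟩, Finset.mem_filter.2 ⟨Finset.mem_univ _, fun h => ?_⟩, rfl⟩
    exact hg0 (by simp [hfl, hgS, h])
  have hμcard : #{g ∈ S | μ g ≠ 0} ≤ ∑ g ∈ S, μ g := by
    rw [Finset.card_filter]
    refine Finset.sum_le_sum fun g _ => ?_
    split_ifs <;> omega
  have hunion : #{g ∈ S | fl g + μ g ≠ 0} ≤ #{g ∈ S | fl g ≠ 0} + #{g ∈ S | μ g ≠ 0} := by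
    refine (Finset.card_le_card fun g hg => ?_).trans (Finset.card_union_le _ _)
    simp only [Finset.mem_filter, Finset.mem_union] at hg ⊢
    have : fl g ≠ 0 ∨ μ g ≠ 0 := by omega
    tauto
  refine hunion.trans ?_
  omega

lemma IntConvex.sub_le_sub {h : ℤ → ℤ} (hh : IntConvex h) {x y s : ℤ} (hxy : x ≤ y)
    (hs : 0 ≤ s) : h (x + s) - h x ≤ h (y + s) - h y := by
  induction s, hs using Int.leInduction with
  | base => simp
  | succ s _ ih =>
    have := hh (x + s) (y + s) (by omega)
    rw [← add_assoc, ← add_assoc]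
    omega

/-- Increments of a convex function are superadditive over steps of the same sign. -/
lemma IntConvex.sum_sub_le {h : ℤ → ℤ} (hh : IntConvex h) {σ : Type*} (T : Finset σ)
    (a : σ → ℤ) (x : ℤ) (ha : (∀ k ∈ T, 0 ≤ a k) ∨ (∀ k ∈ T, a k ≤ 0)) :
    ∑ k ∈ T, (h (x + a k) - h x) ≤ h (x + ∑ k ∈ T, a k) - h x := by
  classical
  induction T using Finset.induction_on with
  | empty => simp
  | insert k T hk ih =>
    rw [Finset.sum_insert hk, Finset.sum_insert hk]
    have ih' := ih (ha.imp (fun H j hj => H j (Finset.mem_insert_of_mem hj))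
      (fun H j hj => H j (Finset.mem_insert_of_mem hj)))
    rcases ha with ha | ha
    · have h1 : 0 ≤ ∑ k ∈ T, a k :=
        Finset.sum_nonneg fun j hj => ha j (Finset.mem_insert_of_mem hj)
      have h2 := hh.sub_le_sub (x := x) (y := x + ∑ k ∈ T, a k) (by omega)
        (ha k (Finset.mem_insert_self k T))
      rw [add_assoc x, add_comm (∑ k ∈ T, a k) (a k)] at h2
      omega
    · have h1 : ∑ k ∈ T, a k ≤ 0 :=
        Finset.sum_nonpos fun j hj => ha j (Finset.mem_insert_of_mem hj)
      have h2 := hh.sub_le_sub (x := x + (a k + ∑ k ∈ T, a k)) (y := x + a k) (s := -a k)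
        (by omega) (by have := ha k (Finset.mem_insert_self k T); omega)
      rw [show x + (a k + ∑ k ∈ T, a k) + -a k = x + ∑ k ∈ T, a k by ring,
        show x + a k + -a k = x by ring] at h2
      omega

/-- If a feasible solution `x` is not optimal (witnessed by a better feasible
solution `xs`), then some Graver basis element `g` together with a step length
`α ≥ 1` yields a feasible step gaining at least a `1/(2n-2)` fraction of the
optimality gap. -/
theorem graver_best_step_gain {m n : ℕ} (hn : 2 ≤ n)
    (A : Matrix (Fin m) (Fin n) ℤ) (b : Fin m → ℤ) (l u : Fin n → ℤ)
    (hlu : ∀ i, l i ≤ u i)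
    (f : (Fin n → ℤ) → ℤ) (hf : SepConvex f)
    (x xs : Fin n → ℤ)
    (hxA : A.mulVec x = b) (hxl : ∀ i, l i ≤ x i) (hxu : ∀ i, x i ≤ u i)
    (hsA : A.mulVec xs = b) (hsl : ∀ i, l i ≤ xs i) (hsu : ∀ i, xs i ≤ u i)
    (hlt : f xs < f x) :
    ∃ g ∈ GraverBasis A, ∃ α : ℤ, 1 ≤ α ∧
      (∀ i, l i ≤ x i + α * g i) ∧ (∀ i, x i + α * g i ≤ u i) ∧
      ((f x : ℚ) - (f (x + α • g) : ℚ)) ≥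
        ((f x : ℚ) - (f xs : ℚ)) / (2 * (n : ℚ) - 2) := by
  obtain ⟨φ, hφ, hfφ⟩ := hf
  set z := xs - x with hz
  have hzA : A.mulVec z = 0 := by rw [hz, Matrix.mulVec_sub, hxA, hsA, sub_self]
  obtain ⟨α, hα, hcard⟩ := exists_sparse_conformal_decomposition hn A z hzA
  set T := {g ∈ graverBelow A z | α g ≠ 0} with hT
  have hαT : ∑ g ∈ T, α g • g = z := by
    rw [← hα]
    refine Finset.sum_filter_of_ne fun g _ hg h0 => hg ?_
    rw [h0, zero_smul]
  have hconf : ∀ g ∈ T, ∀ i, (0 ≤ z i → 0 ≤ α g * g i) ∧ (z i ≤ 0 → α g * g i ≤ 0) := by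
    intro g hg i
    have := conforms_iff.1 (mem_graverBelow.1 (Finset.mem_filter.1 hg).1).2 i
    exact ⟨fun h => mul_nonneg (Int.natCast_nonneg _) (by omega),
      fun h => mul_nonpos_of_nonneg_of_nonpos (Int.natCast_nonneg _) (by omega)⟩
  have hzi : ∀ i, ∑ g ∈ T, (α g : ℤ) * g i = z i := by
    intro i
    rw [← congrFun hαT i]
    simp [Finset.sum_apply]
  have hstep : ∀ g ∈ T, ∀ i,
      (x i ≤ x i + α g * g i ∧ x i + α g * g i ≤ xs i) ∨
      (xs i ≤ x i + α g * g i ∧ x i + α g * g i ≤ x i) := by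
    intro g hg i
    have hx : xs i = x i + z i := by simp [hz]
    rcases le_total 0 (z i) with h | h
    · have h1 := (hconf g hg i).1 h
      have h2 := Finset.single_le_sum (f := fun g => (α g : ℤ) * g i)
        (fun k hk => (hconf k hk i).1 h) hg
      rw [hzi] at h2
      left; omega
    · have h1 := (hconf g hg i).2 h
      have h2 := Finset.single_le_sum (f := fun g => -((α g : ℤ) * g i))
        (fun k hk => neg_nonneg.2 ((hconf k hk i).2 h)) hg
      rw [Finset.sum_neg_distrib, hzi] at h2
      right; omega
  have hsuper : ∑ g ∈ T, (f (x + (α g : ℤ) • g) - f x) ≤ f xs - f x := by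
    simp only [hfφ, ← Finset.sum_sub_distrib]
    rw [Finset.sum_comm]
    refine Finset.sum_le_sum fun i _ => ?_
    have h := (hφ i).sum_sub_le T (fun g => (α g : ℤ) * g i) (x i)
      ((le_total 0 (z i)).imp (fun h g hg => (hconf g hg i).1 h)
        (fun h g hg => (hconf g hg i).2 h))
    rw [hzi] at h
    simpa [hz] using h
  have hne : T.Nonempty := by
    by_contra h
    rw [Finset.not_nonempty_iff_eq_empty] at h
    rw [h, Finset.sum_empty] at hsuper
    omega
  obtain ⟨g, hg, hgain⟩ : ∃ g ∈ T, ((f x : ℚ) - f xs) / (2 * (n : ℚ) - 2) ≤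
      (f x : ℚ) - f (x + (α g : ℤ) • g) := by
    refine Finset.exists_le_of_sum_le hne ?_
    have hn' : (2 : ℚ) ≤ n := by exact_mod_cast hn
    have hD : (0 : ℚ) ≤ (f x : ℚ) - f xs := by
      have : (f xs : ℚ) < f x := by exact_mod_cast hlt
      linarith
    have hc : (#T : ℚ) ≤ 2 * (n : ℚ) - 2 := by
      have : #T + 2 ≤ 2 * n := by omega
      have : (#T : ℚ) + 2 ≤ 2 * n := by exact_mod_cast this
      linarith
    have hs : (f x : ℚ) - f xs ≤ ∑ g ∈ T, ((f x : ℚ) - f (x + (α g : ℤ) • g)) := by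
      have : f x - f xs ≤ ∑ g ∈ T, (f x - f (x + (α g : ℤ) • g)) := by
        rw [Finset.sum_sub_distrib] at hsuper ⊢
        omega
      exact_mod_cast this
    refine le_trans ?_ hs
    rw [Finset.sum_const, nsmul_eq_mul, ← mul_div_assoc, div_le_iff₀ (by linarith), mul_comm]
    exact mul_le_mul_of_nonneg_left hc hD
  obtain ⟨hgS, hα0⟩ := Finset.mem_filter.1 hg
  refine ⟨g, (mem_graverBelow.1 hgS).1, α g, by omega, fun i => ?_, fun i => ?_, hgain⟩
  · have := hstep g hg i
    have := hxl i
    have := hsl i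
    omega
  · have := hstep g hg i
    have := hxu i
    have := hsu i
    omega
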